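/- For a complete m-ary tree T on n vertices with fixed m ≥ 2, the thinness of T is Θ(log n); in particular there exist constants c₁, c₂ > 0 such that c₁·log n ≤ thin(T) ≤ c₂·log n for all sufficiently large complete m-ary trees. -/

import Mathlib

open SimpleGraph

variable {V : Type*}

def Consistent (G : SimpleGraph V) (r : V → V → Prop) {k : ℕ} (C : V → Fin k) : Prop :=
  ∀ u v w, r u v → r v w → C u = C v → G.Adj u w → G.Adj v w

def IsKThin (G : SimpleGraph V) (k : ℕ) : Prop :=
  ∃ r : V → V → Prop, IsStrictTotalOrder V r ∧ ∃ C : V → Fin k, Consistent G r C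

noncomputable def Thinness (G : SimpleGraph V) : ℕ := sInf {k | IsKThin G k}

noncomputable def DanglingThin (G : SimpleGraph V) (v u : V) : ℕ :=
  Thinness (G.induce ((G.deleteEdges {s(v,u)}).connectedComponentMk u).supp)

def KNeighbor (G : SimpleGraph V) (k : ℕ) (x v : V) : Prop :=
  G.Adj x v ∧ ∃ u, G.Adj v u ∧ u ≠ x ∧ k ≤ DanglingThin G v u

def IsChild (G : SimpleGraph V) (rt x v : V) : Prop :=
  G.Adj x v ∧ G.dist rt x + 1 = G.dist rt v

def IsAncestor (G : SimpleGraph V) (rt v x : V) : Prop :=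
  v ≠ x ∧ G.dist rt v + G.dist v x = G.dist rt x

def Subtree (G : SimpleGraph V) (rt v : V) : Set V :=
  {w | G.dist rt v + G.dist v w = G.dist rt w}

def ChildKNeighbor (G : SimpleGraph V) (rt : V) (k : ℕ) (x v : V) : Prop :=
  IsChild G rt x v ∧ KNeighbor G k x v

noncomputable def Critical (G : SimpleGraph V) (rt x : V) : Prop :=
  {v | ChildKNeighbor G rt (Thinness G) x v}.ncard = 2

def IsCompleteMAryTree (G : SimpleGraph V) (rt : V) (m h : ℕ) : Prop :=
  G.IsTree ∧ ∀ v : V,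
    {c | IsChild G rt v c}.ncard = m ∨ ({c | IsChild G rt v c} = ∅ ∧ G.dist rt v = h)

/-- A rooted-tree structure: `R x y` means `x` is the parent of `y`. -/
structure RootedStr {W : Type} (G : SimpleGraph W) (R : W → W → Prop) (d : W → ℕ) : Prop where
  depth : ∀ x y, R x y → d x + 1 = d y
  uniq : ∀ x y z, R x z → R y z → x = y
  adj : ∀ x y, G.Adj x y ↔ R x y ∨ R y x

abbrev Desc {W : Type} (R : W → W → Prop) : W → W → Prop := Relation.ReflTransGen R

/-- Induced matching across the cut at `t`, inside `S`. -/
structure IsMat {W : Type} [LinearOrder W] (G : SimpleGraph W) (S : W → Prop) (t : W)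
    (M : Finset (W × W)) : Prop where
  mem : ∀ e ∈ M, S e.1 ∧ S e.2 ∧ e.1 ≤ t ∧ t < e.2 ∧ G.Adj e.1 e.2
  ind : ∀ e ∈ M, ∀ f ∈ M, e ≠ f → ¬ G.Adj e.1 f.2

theorem rooted_of_tree {W : Type} (G : SimpleGraph W) (rt : W) (hT : G.IsTree) :
    RootedStr G (IsChild G rt) (fun v => G.dist rt v) where
  depth x y h := h.2
  uniq x y z hx hy := by
    obtain ⟨p, hp⟩ := hT.connected.exists_walk_length_eq_dist rt x
    obtain ⟨q, hq⟩ := hT.connected.exists_walk_length_eq_dist rt y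
    have h1 : (p.concat hx.1).IsPath := by
      apply Walk.isPath_of_length_eq_dist
      rw [Walk.length_concat, hp, hx.2]
    have h2 : (q.concat hy.1).IsPath := by
      apply Walk.isPath_of_length_eq_dist
      rw [Walk.length_concat, hq, hy.2]
    have h3 := hT.isAcyclic.path_unique ⟨_, h1⟩ ⟨_, h2⟩
    have h4 : p.concat hx.1 = q.concat hy.1 := congrArg Subtype.val h3
    have h5 := congrArg Walk.penultimate h4
    simpa using h5
  adj x y := by
    constructor
    · intro h
      rcases hT.dist_eq_dist_add_one_of_adj rt h with h' | h'
      · exact Or.inr ⟨h.symm, h'.symm⟩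
      · exact Or.inl ⟨h, h'.symm⟩
    · rintro (h | h)
      · exact h.1
      · exact h.1.symm

namespace RootedStr

variable {W : Type} {G : SimpleGraph W} {R : W → W → Prop} {d : W → ℕ}

theorem desc_depth (hR : RootedStr G R d) {x y : W} (h : Desc R x y) : d x ≤ d y := by
  induction h with
  | refl => exact le_rfl
  | tail _ h ih => have := hR.depth _ _ h; omega

theorem desc_eq (hR : RootedStr G R d) {x y : W} (h : Desc R x y) (hd : d x = d y) : x = y := by
  rcases Relation.ReflTransGen.cases_tail h with h | ⟨c, h1, h2⟩
  · exact h.symm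
  · have := hR.desc_depth h1
    have := hR.depth _ _ h2
    omega

theorem desc_comparable (hR : RootedStr G R d) {x y z : W} (h : Desc R x z) (h' : Desc R y z) :
    Desc R x y ∨ Desc R y x := by
  induction h with
  | refl => exact Or.inr h'
  | @tail b c hb hbc ih =>
    rcases Relation.ReflTransGen.cases_tail h' with e | ⟨b', h1, h2⟩
    · subst e
      exact Or.inl (hb.tail hbc)
    · obtain rfl := hR.uniq _ _ _ hbc h2
      exact ih h1

theorem disjoint (hR : RootedStr G R d) {x y z : W} (hd : d x = d y) (hne : x ≠ y)
    (h : Desc R x z) : ¬ Desc R y z := by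
  intro h'
  rcases hR.desc_comparable h h' with h | h
  · exact hne (hR.desc_eq h hd)
  · exact hne (hR.desc_eq h hd.symm).symm

theorem not_adj (hR : RootedStr G R d) {v u y z : W} (hvu : R v u) (hy : ¬ Desc R v y)
    (hz : Desc R u z) : ¬ G.Adj y z := by
  intro h
  rcases (hR.adj _ _).1 h with h | h
  · rcases Relation.ReflTransGen.cases_tail hz with e | ⟨b, h1, h2⟩
    · subst e
      obtain rfl := hR.uniq _ _ _ h hvu
      exact hy .refl
    · obtain rfl := hR.uniq _ _ _ h h2
      exact hy (h1.head hvu)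
  · exact hy ((hz.head hvu).tail h)

theorem crossing (_hR : RootedStr G R d) (P : W → Prop) {r v y : W} (h : Desc R r y)
    (hy : ¬ Desc R v y) (hP : ¬ (P r ↔ P y)) :
    ∃ a b, R a b ∧ Desc R r a ∧ Desc R r b ∧ ¬ Desc R v a ∧ ¬ Desc R v b ∧ ¬ (P a ↔ P b) := by
  induction h with
  | refl => exact absurd Iff.rfl hP
  | @tail b c hb hbc ih =>
    have hvb : ¬ Desc R v b := fun h => hy (h.tail hbc)
    by_cases hh : P b ↔ P c
    · exact ih hvb (by rwa [hh])
    · exact ⟨b, c, hbc, hb, hb.tail hbc, hvb, hy, hh⟩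

theorem step (hR : RootedStr G R d) [LinearOrder W] {r v u t y z : W} {M : Finset (W × W)}
    (hv : Desc R r v) (hvu : R v u) (hM : IsMat G (Desc R u) t M)
    (hy : Desc R r y) (hz : Desc R r z) (hvy : ¬ Desc R v y) (hvz : ¬ Desc R v z)
    (hyt : y ≤ t) (hzt : t < z) :
    ∃ M', IsMat G (Desc R r) t M' ∧ M'.card = M.card + 1 := by
  have key : ∃ a b, R a b ∧ Desc R r a ∧ Desc R r b ∧ ¬ Desc R v a ∧ ¬ Desc R v b ∧
      ¬ (a ≤ t ↔ b ≤ t) := by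
    by_cases hr : r ≤ t
    · exact hR.crossing (fun x => x ≤ t) hz hvz (by simp [hr, hzt])
    · exact hR.crossing (fun x => x ≤ t) hy hvy (by simp [hr, hyt])
  have key2 : ∃ a b, G.Adj a b ∧ Desc R r a ∧ Desc R r b ∧ ¬ Desc R v a ∧ ¬ Desc R v b ∧
      a ≤ t ∧ t < b := by
    obtain ⟨a, b, hab, ha, hb, hva, hvb, h⟩ := key
    by_cases hat : a ≤ t
    · exact ⟨a, b, (hR.adj _ _).2 (Or.inl hab), ha, hb, hva, hvb, hat,
        not_le.1 fun hb => h (by simp [hat, hb])⟩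
    · refine ⟨b, a, (hR.adj _ _).2 (Or.inr hab), hb, ha, hvb, hva, ?_, not_le.1 hat⟩
      by_contra hb
      exact h (by simp [hat, hb])
  obtain ⟨a, b, hab, ha, hb, hva, hvb, hat, hbt⟩ := key2
  have hru : Desc R r u := hv.tail hvu
  refine ⟨insert (a, b) M, ⟨?_, ?_⟩, ?_⟩
  · intro e he
    rcases Finset.mem_insert.1 he with rfl | he
    · exact ⟨ha, hb, hat, hbt, hab⟩
    · obtain ⟨h1, h2, h3⟩ := hM.mem e he
      exact ⟨hru.trans h1, hru.trans h2, h3⟩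
  · intro e he f hf hef
    rcases Finset.mem_insert.1 he with rfl | he <;> rcases Finset.mem_insert.1 hf with rfl | hf
    · exact absurd rfl hef
    · exact hR.not_adj hvu hva (hM.mem f hf).2.1
    · exact fun h => hR.not_adj hvu hvb (hM.mem e he).1 h.symm
    · exact hM.ind e he f hf hef
  · rw [Finset.card_insert_of_notMem]
    intro h
    exact hva ((hM.mem _ h).1.head hvu)

theorem sorted_step (hR : RootedStr G R d) [LinearOrder W] {r v₁ v₂ v₃ u₁ u₂ u₃ t₁ t₂ t₃ : W}
    {M₁ M₂ M₃ : Finset (W × W)} {j : ℕ}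
    (h₁ : Desc R r v₁ ∧ R v₁ u₁ ∧ IsMat G (Desc R u₁) t₁ M₁ ∧ M₁.card = j + 1)
    (h₂ : Desc R r v₂ ∧ R v₂ u₂ ∧ IsMat G (Desc R u₂) t₂ M₂ ∧ M₂.card = j + 1)
    (h₃ : Desc R r v₃ ∧ R v₃ u₃ ∧ IsMat G (Desc R u₃) t₃ M₃ ∧ M₃.card = j + 1)
    (d12 : d v₁ = d v₂) (d32 : d v₃ = d v₂) (n12 : v₁ ≠ v₂) (n32 : v₃ ≠ v₂)
    (h12 : t₁ ≤ t₂) (h23 : t₂ ≤ t₃) :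
    ∃ t M, IsMat G (Desc R r) t M ∧ M.card = j + 1 + 1 := by
  obtain ⟨a1, b1, c1, e1⟩ := h₁
  obtain ⟨a2, b2, c2, e2⟩ := h₂
  obtain ⟨a3, b3, c3, e3⟩ := h₃
  obtain ⟨f, hf⟩ := Finset.card_pos.1 (show 0 < M₁.card by omega)
  obtain ⟨g, hg⟩ := Finset.card_pos.1 (show 0 < M₃.card by omega)
  obtain ⟨f1, f2, f3, f4, f5⟩ := c1.mem f hf
  obtain ⟨g1, g2, g3, g4, g5⟩ := c3.mem g hg
  have hf1 := f1.head b1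
  have hg2 := g2.head b3
  obtain ⟨M, hM, hc⟩ := hR.step a2 b2 c2 (a1.trans hf1) (a3.trans hg2)
    (hR.disjoint d12 n12 hf1) (hR.disjoint d32 n32 hg2) (f3.trans h12) (h23.trans_lt g4)
  exact ⟨t₂, M, hM, by omega⟩

theorem exists_mat (hR : RootedStr G R d) [LinearOrder W] (h : ℕ)
    (hc : ∀ v, d v < h → ∃ x y, x ≠ y ∧ R v x ∧ R v y) (j : ℕ) :
    ∀ r, d r + 3 * j + 1 ≤ h → ∃ t M, IsMat G (Desc R r) t M ∧ M.card = j + 1 := by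
  induction j with
  | zero =>
    intro r hr
    obtain ⟨x, y, _, hx, _⟩ := hc r (by omega)
    have hadj := (hR.adj _ _).2 (Or.inl hx)
    have hd := Relation.ReflTransGen.single hx
    rcases lt_or_gt_of_ne hadj.ne with hlt | hlt
    · exact ⟨r, {(r, x)}, ⟨by simp [hlt, hadj, hd, Desc, Relation.ReflTransGen.refl], by simp⟩, by simp⟩
    · exact ⟨x, {(x, r)}, ⟨by simp [hlt, hadj.symm, hd, Desc, Relation.ReflTransGen.refl], by simp⟩, by simp⟩
  | succ j ih =>
    intro r hr
    obtain ⟨x, y, hxy, hx, hy⟩ := hc r (by omega)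
    have dx := hR.depth _ _ hx
    have dy := hR.depth _ _ hy
    obtain ⟨v₁, v₂, n12, hv1, hv2⟩ := hc x (by omega)
    obtain ⟨v₃, _, _, hv3, _⟩ := hc y (by omega)
    have dv1 := hR.depth _ _ hv1
    have dv2 := hR.depth _ _ hv2
    have dv3 := hR.depth _ _ hv3
    have n13 : v₁ ≠ v₃ := by
      rintro rfl; exact hxy (hR.uniq _ _ _ hv1 hv3)
    have n23 : v₂ ≠ v₃ := by
      rintro rfl; exact hxy (hR.uniq _ _ _ hv2 hv3)
    obtain ⟨u₁, _, _, hu1, _⟩ := hc v₁ (by omega)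
    obtain ⟨u₂, _, _, hu2, _⟩ := hc v₂ (by omega)
    obtain ⟨u₃, _, _, hu3, _⟩ := hc v₃ (by omega)
    have du1 := hR.depth _ _ hu1
    have du2 := hR.depth _ _ hu2
    have du3 := hR.depth _ _ hu3
    obtain ⟨t₁, M₁, m1, k1⟩ := ih u₁ (by omega)
    obtain ⟨t₂, M₂, m2, k2⟩ := ih u₂ (by omega)
    obtain ⟨t₃, M₃, m3, k3⟩ := ih u₃ (by omega)
    have q1 : Desc R r v₁ ∧ R v₁ u₁ ∧ IsMat G (Desc R u₁) t₁ M₁ ∧ M₁.card = j + 1 :=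
      ⟨(Relation.ReflTransGen.single hx).tail hv1, hu1, m1, k1⟩
    have q2 : Desc R r v₂ ∧ R v₂ u₂ ∧ IsMat G (Desc R u₂) t₂ M₂ ∧ M₂.card = j + 1 :=
      ⟨(Relation.ReflTransGen.single hx).tail hv2, hu2, m2, k2⟩
    have q3 : Desc R r v₃ ∧ R v₃ u₃ ∧ IsMat G (Desc R u₃) t₃ M₃ ∧ M₃.card = j + 1 :=
      ⟨(Relation.ReflTransGen.single hy).tail hv3, hu3, m3, k3⟩
    rcases le_total t₁ t₂ with h12 | h12 <;> rcases le_total t₂ t₃ with h23 | h23 <;>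
      rcases le_total t₁ t₃ with h13 | h13
    · exact hR.sorted_step q1 q2 q3 (by omega) (by omega) n12 n23.symm h12 h23
    · exact hR.sorted_step q1 q2 q3 (by omega) (by omega) n12 n23.symm h12 h23
    · exact hR.sorted_step q1 q3 q2 (by omega) (by omega) n13 n23 h13 h23
    · exact hR.sorted_step q3 q1 q2 (by omega) (by omega) n13.symm n12.symm h13 h12
    · exact hR.sorted_step q2 q1 q3 (by omega) (by omega) n12.symm n13.symm h12 h13
    · exact hR.sorted_step q2 q3 q1 (by omega) (by omega) n23 n13 h23 h13
    · exact hR.sorted_step q3 q2 q1 (by omega) (by omega) n23.symm n12 h23 h12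
    · exact hR.sorted_step q3 q2 q1 (by omega) (by omega) n23.symm n12 h23 h12

end RootedStr

theorem mat_card_le {W : Type} [LinearOrder W] {G : SimpleGraph W} {S : W → Prop} {t : W}
    {M : Finset (W × W)} (hM : IsMat G S t M) {k : ℕ} (C : W → Fin k)
    (hC : Consistent G (fun x y => x < y) C) : M.card ≤ k := by
  have := Finset.card_le_card_of_injOn (s := M) (t := Finset.univ) (fun e => C e.1)
    (by intro _ _; simp) (by
      intro e he f hf hef
      by_contra hne
      obtain ⟨-, -, e3, e4, e5⟩ := hM.mem e he
      obtain ⟨-, -, f3, f4, f5⟩ := hM.mem f hf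
      rcases lt_trichotomy e.1 f.1 with hlt | heq | hlt
      · exact hM.ind f hf e he (Ne.symm hne) (hC _ _ _ hlt (f3.trans_lt e4) hef e5)
      · exact hM.ind f hf e he (Ne.symm hne) (heq ▸ e5)
      · exact hM.ind e he f hf hne (hC _ _ _ hlt (e3.trans_lt f4) hef.symm f5))
  simpa using this

theorem lower_thin {W : Type} {G : SimpleGraph W} {R : W → W → Prop} {d : W → ℕ}
    (hR : RootedStr G R d) (h : ℕ)
    (hc : ∀ v, d v < h → ∃ x y, x ≠ y ∧ R v x ∧ R v y) (rt : W) (h0 : d rt = 0) (j k : ℕ)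
    (hj : 3 * j + 1 ≤ h) (hk : IsKThin G k) : j + 1 ≤ k := by
  classical
  obtain ⟨r, hr, C, hC⟩ := hk
  letI : LinearOrder W := linearOrderOfSTO r
  obtain ⟨t, M, hM, hcard⟩ := hR.exists_mat h hc j rt (by omega)
  rw [← hcard]
  exact mat_card_le hM C hC

theorem lex_between {α : Type} [LinearOrder α] (a : α) : ∀ (L M : List α), L < M → M < L ++ [a] →
    M.length = L.length + 1 → ∃ b, M = L ++ [b] := by
  intro L
  induction L with
  | nil =>
    intro M _ _ hl
    obtain ⟨b, rfl⟩ := List.length_eq_one_iff.1 hl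
    exact ⟨b, rfl⟩
  | cons x L ih =>
    intro M h1 h2 hl
    cases M with
    | nil => simp at hl
    | cons y M =>
      rw [List.cons_append] at h2
      rw [List.cons_lt_cons_iff] at h1 h2
      have hxy : x = y := by
        rcases h1 with h1 | h1 <;> rcases h2 with h2 | h2
        · exact absurd (h1.trans h2) (lt_irrefl _)
        · exact h2.1.symm
        · exact h1.1
        · exact h1.1
      subst hxy
      obtain ⟨b, rfl⟩ := ih M (by simpa using h1) (by simpa using h2) (by simpa using hl)
      exact ⟨b, rfl⟩

def keyAux {W : Type} (p : W → W) : ℕ → W → List W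
  | 0, v => [v]
  | n + 1, v => keyAux p n (p v) ++ [v]

theorem keyAux_length {W : Type} (p : W → W) (n : ℕ) : ∀ v, (keyAux p n v).length = n + 1 := by
  induction n with
  | zero => intro v; rfl
  | succ n ih => intro v; simp [keyAux, ih]

theorem keyAux_last {W : Type} (p : W → W) (n : ℕ) (v : W) :
    (keyAux p n v).getLast? = some v := by
  cases n <;> simp [keyAux]

theorem upper_thin {W : Type} [Finite W] {G : SimpleGraph W} {R : W → W → Prop} {d : W → ℕ}
    (hR : RootedStr G R d) (h : ℕ) (hd : ∀ v, d v ≤ h) (hp : ∀ v, d v ≠ 0 → ∃ x, R x v) :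
    IsKThin G (h + 1) := by
  classical
  letI : LinearOrder W := linearOrderOfSTO (WellOrderingRel)
  have : ∃ p : W → W, ∀ v, d v ≠ 0 → R (p v) v := by
    refine ⟨fun v => if hv : d v ≠ 0 then (hp v hv).choose else v, fun v hv => ?_⟩
    simp only [hv, ne_eq, not_false_eq_true, dite_true]
    exact (hp v hv).choose_spec
  obtain ⟨p, hp⟩ := this
  let key : W → List W := fun v => keyAux p (d v) v
  have hinj : Function.Injective key := by
    intro a b hab
    have h1 := keyAux_last p (d a) a
    have h2 := keyAux_last p (d b) b
    have hab' : keyAux p (d a) a = keyAux p (d b) b := hab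
    rw [hab', h2] at h1
    exact (Option.some.inj h1).symm
  have hkey : ∀ x y, R x y → key y = key x ++ [y] := by
    intro x y hxy
    have hdep := hR.depth _ _ hxy
    obtain rfl := hR.uniq _ _ _ hxy (hp y (by omega))
    change keyAux p (d y) y = _
    rw [← hdep]
    rfl
  have hlen : ∀ v, (key v).length = d v + 1 := fun v => keyAux_length p _ _
  refine ⟨fun u v => key v < key u, ?_, fun v => ⟨d v, by have := hd v; omega⟩, ?_⟩
  · exact { trichotomous := fun a b h1 h2 => hinj (le_antisymm (not_lt.1 h1) (not_lt.1 h2))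
            irrefl := fun a => lt_irrefl _
            trans := fun a b c h1 h2 => lt_trans h2 h1 }
  · intro u v w huv hvw hC hadj
    have hduv : d u = d v := by simpa using hC
    rcases (hR.adj _ _).1 hadj with hh | hh
    · exfalso
      have h1 : key w < key u := hvw.trans huv
      rw [hkey _ _ hh] at h1
      exact (List.not_lt_iff_ge.2 List.le_append_left) h1
    · have hdep := hR.depth _ _ hh
      have hku := hkey _ _ hh
      have huv' : key v < key w ++ [u] := hku ▸ huv
      obtain ⟨b, hb⟩ := lex_between u _ _ hvw huv' (by rw [hlen, hlen]; omega)
      have hpv := hp v (by omega)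
      rw [hkey _ _ hpv] at hb
      have := hinj (List.append_inj_left' hb rfl)
      rw [this] at hpv
      exact (hR.adj _ _).2 (Or.inr hpv)

theorem level_card {W : Type} [Fintype W] {G : SimpleGraph W} {R : W → W → Prop} {d : W → ℕ}
    (hR : RootedStr G R d) (m h : ℕ) (rt : W) (h0 : ∀ v, d v = 0 ↔ v = rt)
    (hp : ∀ v, d v ≠ 0 → ∃ x, R x v)
    (hc : ∀ v, d v < h → {x | R v x}.ncard = m) (i : ℕ) (hi : i ≤ h) :
    {v | d v = i}.ncard = m ^ i := by
  classical
  induction i with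
  | zero =>
    have : {v | d v = 0} = {rt} := by ext v; simp [h0]
    rw [this]; simp
  | succ i ih =>
    have ih := ih (by omega)
    rw [Set.ncard_eq_toFinset_card'] at ih ⊢
    have hU : {v | d v = i + 1}.toFinset =
        ({v | d v = i}.toFinset).biUnion (fun v => {x | R v x}.toFinset) := by
      ext v
      simp only [Set.mem_toFinset, Set.mem_setOf_eq, Finset.mem_biUnion]
      constructor
      · intro hv
        obtain ⟨x, hx⟩ := hp v (by omega)
        have := hR.depth _ _ hx
        exact ⟨x, by omega, hx⟩
      · rintro ⟨x, hx, hxv⟩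
        have := hR.depth _ _ hxv
        omega
    rw [hU, Finset.card_biUnion]
    · rw [Finset.sum_const_nat (m := m)]
      · rw [ih, pow_succ]
      · intro v hv
        have hv : d v = i := by simpa using hv
        rw [← Set.ncard_eq_toFinset_card']
        exact hc v (by omega)
    · intro x _ y _ hxy
      rw [Function.onFun, Finset.disjoint_left]
      intro z hz hz'
      exact hxy (hR.uniq _ _ _ (by simpa using hz) (by simpa using hz'))

theorem geom_bound (m : ℕ) (hm : 2 ≤ m) (k : ℕ) : ∑ i ∈ Finset.range k, m ^ i ≤ m ^ k := by
  induction k with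
  | zero => simp
  | succ k ih =>
    rw [Finset.sum_range_succ, pow_succ]
    nlinarith [Nat.zero_le (m ^ k)]

theorem thinness_m_ary_theta_log (m : ℕ) (hm : 2 ≤ m) :
    ∃ c₁ c₂ : ℝ, 0 < c₁ ∧ 0 < c₂ ∧ ∃ N : ℕ,
      ∀ (W : Type) [Fintype W] (G : SimpleGraph W) (rt : W) (h : ℕ),
        IsCompleteMAryTree G rt m h → N ≤ Fintype.card W →
          c₁ * Real.log (Fintype.card W) ≤ (Thinness G : ℝ) ∧
          (Thinness G : ℝ) ≤ c₂ * Real.log (Fintype.card W) := by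
  have hlm : 0 < Real.log m := Real.log_pos (by exact_mod_cast hm)
  have hl2 : 0 < Real.log 2 := Real.log_pos (by norm_num)
  refine ⟨1 / (6 * Real.log m), 2 / Real.log 2, by positivity, by positivity, m + 1, ?_⟩
  intro W _ G rt h ⟨hT, hG⟩ hN
  classical
  have hR := rooted_of_tree G rt hT
  have hcm : ∀ v, G.dist rt v < h → {x | IsChild G rt v x}.ncard = m := by
    intro v hv
    rcases hG v with h1 | h1
    · exact h1
    · omega
  have hc2 : ∀ v, {x | IsChild G rt v x}.ncard = m →
      ∃ x y, x ≠ y ∧ IsChild G rt v x ∧ IsChild G rt v y := by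
    intro v hv
    obtain ⟨x, hx, y, hy, hxy⟩ := (Set.one_lt_ncard (Set.toFinite _)).1 (show 1 < _ by rw [hv]; omega)
    exact ⟨x, y, hxy, hx, hy⟩
  have hd : ∀ v, G.dist rt v ≤ h := by
    haveI : Nonempty W := ⟨rt⟩
    obtain ⟨w, hw⟩ := Finite.exists_max (fun v : W => G.dist rt v)
    suffices G.dist rt w ≤ h from fun v => (hw v).trans this
    rcases hG w with h1 | h1
    · obtain ⟨x, _, _, hx, _⟩ := hc2 w h1
      have := hw x
      have := hx.2
      omega
    · exact h1.2.le
  have h0 : ∀ v, G.dist rt v = 0 ↔ v = rt := by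
    intro v
    rw [hT.connected.dist_eq_zero_iff, eq_comm]
  have hp : ∀ v, G.dist rt v ≠ 0 → ∃ x, IsChild G rt x v := by
    intro v hv
    obtain ⟨p, hp⟩ := hT.connected.exists_walk_length_eq_dist rt v
    have hnil : ¬ p.Nil := by
      rw [← Walk.length_eq_zero_iff]; omega
    have hadj := p.adj_penultimate hnil
    refine ⟨p.penultimate, hadj, ?_⟩
    have h1 := dist_le p.dropLast
    have h2 : p.dropLast.length + 1 = p.length := Walk.length_dropLast_add_one hnil
    rcases hT.dist_eq_dist_add_one_of_adj rt hadj with h' | h' <;> omega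
  have hlev := level_card hR m h rt h0 hp hcm
  have hthin : IsKThin G (h + 1) := upper_thin hR h hd hp
  have hub : Thinness G ≤ h + 1 := Nat.sInf_le hthin
  have hmem : IsKThin G (Thinness G) := Nat.sInf_mem (s := {k | IsKThin G k}) ⟨_, hthin⟩
  have hn1 : m ^ h ≤ Fintype.card W := by
    rw [← hlev h le_rfl, ← Nat.card_eq_fintype_card]
    exact Set.ncard_le_card _
  have hn2 : Fintype.card W ≤ m ^ (h + 1) := by
    refine le_trans (le_of_eq ?_) (geom_bound m hm (h + 1))
    rw [← Finset.card_univ, Finset.card_eq_sum_card_fiberwise (f := fun v => G.dist rt v)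
      (t := Finset.range (h + 1))]
    · refine Finset.sum_congr rfl fun i hi => ?_
      rw [← hlev i (by simpa [Nat.lt_succ_iff] using hi), Set.ncard_eq_toFinset_card']
      congr 1
      ext v; simp
    · intro v _
      have := hd v
      simp; omega
  have hh : 1 ≤ h := by
    by_contra hlt
    have : h = 0 := by omega
    subst this
    simp at hn2; omega
  have hlow : h ≤ 3 * Thinness G := by
    have := lower_thin hR h (fun v hv => hc2 v (hcm v hv)) rt (by simp) ((h - 1) / 3)
      (Thinness G) (by omega) hmem
    omega
  have hnpos : (0 : ℝ) < Fintype.card W := by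
    have : 0 < Fintype.card W := by omega
    exact_mod_cast this
  have hL1 : (h : ℝ) * Real.log 2 ≤ Real.log (Fintype.card W) := by
    rw [← Real.log_pow]
    apply Real.log_le_log (by positivity)
    have : 2 ^ h ≤ Fintype.card W := (Nat.pow_le_pow_left hm h).trans hn1
    exact_mod_cast this
  have hL2 : Real.log (Fintype.card W) ≤ ((h : ℝ) + 1) * Real.log m := by
    have : Real.log (Fintype.card W) ≤ Real.log ((m : ℝ) ^ (h + 1)) := by
      apply Real.log_le_log hnpos
      exact_mod_cast hn2
    rw [Real.log_pow] at this
    exact_mod_cast this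
  have hhR : (1 : ℝ) ≤ h := by exact_mod_cast hh
  have hlowR : (h : ℝ) ≤ 3 * Thinness G := by exact_mod_cast hlow
  have hubR : (Thinness G : ℝ) ≤ h + 1 := by exact_mod_cast hub
  constructor
  · rw [one_div, inv_mul_le_iff₀ (by positivity)]
    nlinarith
  · rw [div_mul_eq_mul_div, le_div_iff₀ hl2]
    nlinarith
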